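/- arXiv:1102.2000 — 9 statements merged into one kernel-verified Lean document; each statement's English description precedes it below -/
import Mathlib

section
/- Let X be a Stone MV-space with MV-topology Ω and let Clop denote its set of clopen fuzzy subsets. Then the map sending each point x ∈ X to the set f(x) = {o ∈ Clop : o(x) = 0} is a bijection from X onto the set of maximal ideals of Clop. -/
open Set unitInterval

noncomputable section

instance : Fact ((0:ℝ) ≤ 1) := ⟨zero_le_one⟩

noncomputable instance : CompleteLattice unitInterval := Set.Icc.completeLattice

namespace MVStone

/-- Truncated sum on [0,1]. -/
def oplus (a b : unitInterval) : unitInterval :=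
  ⟨min (a.1 + b.1) 1, ⟨le_min (add_nonneg a.2.1 b.2.1) zero_le_one, min_le_right _ _⟩⟩

/-- Truncated product (Łukasiewicz t-norm) on [0,1]. -/
def odot (a b : unitInterval) : unitInterval :=
  ⟨max (a.1 + b.1 - 1) 0, ⟨le_max_right _ _, max_le (by have := a.2.2; have := b.2.2; linarith) zero_le_one⟩⟩

/-- Truncated difference on [0,1]. -/
def ominus (a b : unitInterval) : unitInterval :=
  ⟨max (a.1 - b.1) 0, ⟨le_max_right _ _, max_le (by have := a.2.2; have := b.2.1; linarith) zero_le_one⟩⟩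

variable {X : Type*}

def pOplus (α β : X → unitInterval) : X → unitInterval := fun x => oplus (α x) (β x)
def pOdot (α β : X → unitInterval) : X → unitInterval := fun x => odot (α x) (β x)
def pStar (α : X → unitInterval) : X → unitInterval := fun x => σ (α x)
def pMin (α β : X → unitInterval) : X → unitInterval := fun x => min (α x) (β x)
def pMax (α β : X → unitInterval) : X → unitInterval := fun x => max (α x) (β x)

/-- Pointwise supremum of a family of fuzzy subsets. -/
def pSup (Γ : Set (X → unitInterval)) : X → unitInterval := fun x => ⨆ α ∈ Γ, α x
/-- Pointwise infimum of a family of fuzzy subsets. -/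
def pInf (Γ : Set (X → unitInterval)) : X → unitInterval := fun x => ⨅ α ∈ Γ, α x

structure IsMVTopology (Ω : Set (X → unitInterval)) : Prop where
  zero_mem : (fun _ => (0 : unitInterval)) ∈ Ω
  one_mem : (fun _ => (1 : unitInterval)) ∈ Ω
  sSup_mem : ∀ Γ ⊆ Ω, pSup Γ ∈ Ω
  oplus_mem : ∀ α ∈ Ω, ∀ β ∈ Ω, pOplus α β ∈ Ω
  odot_mem : ∀ α ∈ Ω, ∀ β ∈ Ω, pOdot α β ∈ Ω
  min_mem : ∀ α ∈ Ω, ∀ β ∈ Ω, pMin α β ∈ Ω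

def IsCovering (Γ : Set (X → unitInterval)) : Prop := pSup Γ = fun _ => 1

/-- `⊕`-sum of a finite list of fuzzy subsets. -/
def sumList (l : List (X → unitInterval)) : X → unitInterval :=
  l.foldr pOplus (fun _ => 0)

/-- Compactness: every open covering contains a finite list whose `⊕`-sum is `1`. -/
def MVCompact (Ω : Set (X → unitInterval)) : Prop :=
  ∀ Γ ⊆ Ω, IsCovering Γ →
    ∃ l : List (X → unitInterval), (∀ o ∈ l, o ∈ Γ) ∧ sumList l = fun _ => 1

/-- Strong compactness: every open covering contains a finite subcovering. -/
def MVStronglyCompact (Ω : Set (X → unitInterval)) : Prop :=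
  ∀ Γ ⊆ Ω, IsCovering Γ → ∃ F ⊆ Γ, F.Finite ∧ IsCovering F

def MVHausdorff (Ω : Set (X → unitInterval)) : Prop :=
  ∀ x y : X, x ≠ y → ∃ ox ∈ Ω, ∃ oy ∈ Ω,
    ox x = 1 ∧ oy y = 1 ∧ pMin ox oy = fun _ => 0

def IsBase (Ω Θ : Set (X → unitInterval)) : Prop :=
  Θ ⊆ Ω ∧ ∀ o ∈ Ω, ∃ G ⊆ Θ, o = pSup G

def MVClopen (Ω : Set (X → unitInterval)) (α : X → unitInterval) : Prop :=
  α ∈ Ω ∧ pStar α ∈ Ω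

def Clop (Ω : Set (X → unitInterval)) : Set (X → unitInterval) := {α | MVClopen Ω α}

def IsStoneMVSpace (Ω : Set (X → unitInterval)) : Prop :=
  IsMVTopology Ω ∧ MVCompact Ω ∧ MVHausdorff Ω ∧
    ∃ Θ, IsBase Ω Θ ∧ ∀ θ ∈ Θ, MVClopen Ω θ

/-- Ideal of a set `A` of fuzzy subsets closed under `⊕` (w.r.t. the pointwise order). -/
def IsIdealOf (A M : Set (X → unitInterval)) : Prop :=
  M ⊆ A ∧ (fun _ => (0 : unitInterval)) ∈ M ∧ (∀ a ∈ M, ∀ b ∈ M, pOplus a b ∈ M) ∧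
    ∀ a ∈ A, ∀ b ∈ M, a ≤ b → a ∈ M

def IsMaximalIdealOf (A M : Set (X → unitInterval)) : Prop :=
  IsIdealOf A M ∧ M ≠ A ∧ ∀ N, IsIdealOf A N → N ≠ A → M ⊆ N → M = N


theorem pStar_pStar (α : X → unitInterval) : pStar (pStar α) = α := by
  funext x
  simp [pStar]

theorem pStar_pOplus (α β : X → unitInterval) :
    pStar (pOplus α β) = pOdot (pStar α) (pStar β) := by
  funext x
  apply Subtype.ext
  simp only [pStar, pOplus, pOdot, oplus, odot, unitInterval.coe_symm_eq]
  rcases le_total ((α x : ℝ) + β x) 1 with h | h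
  · rw [min_eq_left h, max_eq_left (by linarith)]
    ring
  · rw [min_eq_right h, max_eq_right (by linarith)]
    ring

theorem pOplus_pStar_self (α : X → unitInterval) : pOplus α (pStar α) = fun _ => 1 := by
  funext x
  apply Subtype.ext
  simp [pStar, pOplus, oplus]

theorem pStar_mem_Clop {Ω : Set (X → unitInterval)} {α : X → unitInterval}
    (hα : α ∈ Clop Ω) : pStar α ∈ Clop Ω :=
  ⟨hα.2, (pStar_pStar α).symm ▸ hα.1⟩

theorem IsMVTopology.zero_mem_Clop {Ω : Set (X → unitInterval)} (hΩ : IsMVTopology Ω) :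
    (fun _ => (0 : unitInterval)) ∈ Clop Ω := by
  refine ⟨hΩ.zero_mem, ?_⟩
  have : pStar (fun _ : X => (0 : unitInterval)) = fun _ => 1 := by
    funext x
    simp [pStar]
  exact this ▸ hΩ.one_mem

theorem IsMVTopology.one_mem_Clop {Ω : Set (X → unitInterval)} (hΩ : IsMVTopology Ω) :
    (fun _ => (1 : unitInterval)) ∈ Clop Ω := by
  refine ⟨hΩ.one_mem, ?_⟩
  have : pStar (fun _ : X => (1 : unitInterval)) = fun _ => 0 := by
    funext x
    simp [pStar]
  exact this ▸ hΩ.zero_mem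

theorem IsMVTopology.pOplus_mem_Clop {Ω : Set (X → unitInterval)} (hΩ : IsMVTopology Ω)
    {α β : X → unitInterval} (hα : α ∈ Clop Ω) (hβ : β ∈ Clop Ω) : pOplus α β ∈ Clop Ω :=
  ⟨hΩ.oplus_mem _ hα.1 _ hβ.1, pStar_pOplus α β ▸ hΩ.odot_mem _ hα.2 _ hβ.2⟩

theorem IsIdealOf.sumList_mem {A M : Set (X → unitInterval)} (hM : IsIdealOf A M)
    {l : List (X → unitInterval)} (hl : ∀ o ∈ l, o ∈ M) : sumList l ∈ M := by
  induction l with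
  | nil => exact hM.2.1
  | cons a l ih =>
    exact hM.2.2.1 _ (hl a (by simp)) _ (ih fun o ho => hl o (by simp [ho]))

theorem IsIdealOf.eq_of_one_mem {A M : Set (X → unitInterval)} (hM : IsIdealOf A M)
    (h1 : (fun _ => (1 : unitInterval)) ∈ M) : M = A :=
  hM.1.antisymm fun a ha => hM.2.2.2 a ha _ h1 fun x => (a x).2.2

theorem coe_sumList_replicate (α : X → unitInterval) (n : ℕ) (x : X) :
    (sumList (List.replicate n α) x : ℝ) = min (n * (α x : ℝ)) 1 := by
  induction n with
  | zero => simp [sumList]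
  | succ n ih =>
    have hs : (sumList (List.replicate (n + 1) α) x : ℝ) =
        min ((α x : ℝ) + sumList (List.replicate n α) x) 1 := rfl
    rw [hs, ih]
    push_cast
    have h0 : (0 : ℝ) ≤ α x := (α x).2.1
    rcases le_total ((n : ℝ) * (α x : ℝ)) 1 with h | h
    · rw [min_eq_left h]
      ring_nf
    · rw [min_eq_right h, min_eq_right (by linarith), min_eq_right (by linarith)]

theorem exists_sumList_replicate_eq_one {α : X → unitInterval} {x : X} (hx : α x ≠ 0) :
    ∃ n : ℕ, sumList (List.replicate n α) x = 1 := by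
  have hpos : (0 : ℝ) < α x :=
    lt_of_le_of_ne (α x).2.1 fun h => hx (Subtype.ext h.symm)
  obtain ⟨n, hn⟩ := exists_nat_ge (1 / (α x : ℝ))
  refine ⟨n, Subtype.ext ?_⟩
  rw [coe_sumList_replicate]
  exact min_eq_right ((div_le_iff₀ hpos).1 hn)

/-- An ideal not vanishing at `x` has a member taking the value `1` at `x`. -/
theorem IsIdealOf.exists_eq_one {A M : Set (X → unitInterval)} (hM : IsIdealOf A M)
    {α : X → unitInterval} (hα : α ∈ M) {x : X} (hx : α x ≠ 0) : ∃ β ∈ M, β x = 1 := by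
  obtain ⟨n, hn⟩ := exists_sumList_replicate_eq_one hx
  exact ⟨_, hM.sumList_mem fun o ho => List.eq_of_mem_replicate ho ▸ hα, hn⟩

theorem le_pSup {Γ : Set (X → unitInterval)} {α : X → unitInterval} (hα : α ∈ Γ) (x : X) :
    α x ≤ pSup Γ x :=
  le_iSup₂ (f := fun (β : X → unitInterval) (_ : β ∈ Γ) => β x) α hα

theorem pSup_eq_zero {Γ : Set (X → unitInterval)} {x : X} (h : ∀ α ∈ Γ, α x = 0) :
    pSup Γ x = 0 :=
  le_antisymm (iSup₂_le fun α hα => (h α hα).le) (pSup Γ x).2.1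

theorem isIdealOf_vanishing {Ω : Set (X → unitInterval)} (hΩ : IsMVTopology Ω) (x : X) :
    IsIdealOf (Clop Ω) {o ∈ Clop Ω | o x = 0} := by
  refine ⟨fun _ ho => ho.1, ⟨hΩ.zero_mem_Clop, rfl⟩, ?_, ?_⟩
  · rintro a ⟨ha, hax⟩ b ⟨hb, hbx⟩
    refine ⟨hΩ.pOplus_mem_Clop ha hb, Subtype.ext ?_⟩
    simp [pOplus, oplus, hax, hbx]
  · rintro a ha b ⟨-, hbx⟩ hab
    exact ⟨ha, le_antisymm (hbx ▸ hab x) (a x).2.1⟩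

theorem vanishing_ne_Clop {Ω : Set (X → unitInterval)} (hΩ : IsMVTopology Ω) (x : X) :
    {o ∈ Clop Ω | o x = 0} ≠ Clop Ω := fun h => by
  have h1 := hΩ.one_mem_Clop
  rw [← h] at h1
  exact one_ne_zero h1.2

theorem isMaximalIdealOf_vanishing {Ω : Set (X → unitInterval)} (hΩ : IsMVTopology Ω) (x : X) :
    IsMaximalIdealOf (Clop Ω) {o ∈ Clop Ω | o x = 0} := by
  refine ⟨isIdealOf_vanishing hΩ x, vanishing_ne_Clop hΩ x, fun N hN hne hsub => ?_⟩
  refine hsub.antisymm fun a ha => ⟨hN.1 ha, ?_⟩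
  by_contra hax
  obtain ⟨b, hb, hbx⟩ := hN.exists_eq_one ha hax
  have hb' : pStar b ∈ N := hsub ⟨pStar_mem_Clop (hN.1 hb), by simp [pStar, hbx]⟩
  exact hne (hN.eq_of_one_mem (pOplus_pStar_self b ▸ hN.2.2.1 _ hb _ hb'))

theorem exists_mem_Clop_separating {Ω : Set (X → unitInterval)} (h : IsStoneMVSpace Ω)
    {x y : X} (hxy : x ≠ y) : ∃ θ ∈ Clop Ω, θ x ≠ 0 ∧ θ y = 0 := by
  obtain ⟨-, -, hH, Θ, ⟨-, hbase⟩, hΘ⟩ := h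
  obtain ⟨u, hu, v, -, hux, hvy, huv⟩ := hH x y hxy
  have huy : u y = 0 := by
    have := congrFun huv y
    simp only [pMin, hvy] at this
    exact (min_eq_left (show u y ≤ 1 from (u y).2.2)).symm.trans this
  obtain ⟨G, hG, rfl⟩ := hbase u hu
  have : ∃ θ ∈ G, θ x ≠ 0 := by
    by_contra! hall
    exact one_ne_zero (hux.symm.trans (pSup_eq_zero hall))
  obtain ⟨θ, hθ, hθx⟩ := this
  exact ⟨θ, hΘ θ (hG hθ), hθx, le_antisymm (huy ▸ le_pSup hθ y) (θ y).2.1⟩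

theorem IsIdealOf.exists_forall_eq_zero {Ω M : Set (X → unitInterval)} (hΩ : MVCompact Ω)
    (hM : IsIdealOf (Clop Ω) M) (hne : M ≠ Clop Ω) : ∃ x : X, ∀ o ∈ M, o x = 0 := by
  by_contra! hall
  have hcov : IsCovering M := by
    funext x
    obtain ⟨a, ha, hax⟩ := hall x
    obtain ⟨b, hb, hbx⟩ := hM.exists_eq_one ha hax
    exact le_antisymm (pSup M x).2.2 (hbx ▸ le_pSup hb x)
  obtain ⟨l, hl, hsum⟩ := hΩ M (fun o ho => (hM.1 ho).1) hcov
  exact hne (hM.eq_of_one_mem (hsum ▸ hM.sumList_mem hl))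

theorem stmt0 {X : Type*} (Ω : Set (X → unitInterval)) (h : IsStoneMVSpace Ω) :
    (∀ x : X, IsMaximalIdealOf (Clop Ω) {o ∈ Clop Ω | o x = 0}) ∧
    Function.Injective (fun x : X => {o ∈ Clop Ω | o x = 0}) ∧
    ∀ M, IsMaximalIdealOf (Clop Ω) M → ∃ x : X, {o ∈ Clop Ω | o x = 0} = M := by
  refine ⟨isMaximalIdealOf_vanishing h.1, fun x y hxy => ?_, fun M hM => ?_⟩
  · by_contra hne
    obtain ⟨θ, hθ, hθx, hθy⟩ := exists_mem_Clop_separating h hne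
    have hmem : θ ∈ {o ∈ Clop Ω | o y = 0} := ⟨hθ, hθy⟩
    exact hθx ((Set.ext_iff.1 hxy θ).2 hmem).2
  · obtain ⟨x, hx⟩ := hM.1.exists_forall_eq_zero h.2.1 hM.2.1
    exact ⟨x, (hM.2.2 _ (isIdealOf_vanishing h.1 x) (vanishing_ne_Clop h.1 x)
      fun o ho => ⟨hM.1.1 ho, hx o ho⟩).symm⟩

end MVStone
end
end

section
/- Let A be an MV-subalgebra of [0,1]^S. A cut X of A is a limit cut if and only if there exists a cut Y of A such that the pointwise supremum of X (computed in [0,1]^S) equals the pointwise infimum of the set Y* = {y* : y ∈ Y}; moreover, in that case Y is a limit cut as well. -/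
open Set unitInterval

noncomputable section

namespace MVStone

variable {X : Type*}

variable {S : Type*}

/-- MV-subalgebra of `[0,1]^S`. -/
def IsMVSubalgebra (A : Set (S → unitInterval)) : Prop :=
  (fun _ => (0 : unitInterval)) ∈ A ∧ (∀ a ∈ A, ∀ b ∈ A, pOplus a b ∈ A) ∧
    ∀ a ∈ A, pStar a ∈ A

/-- Upper bounds of `X` within `A` (pointwise order). -/
def ub (A X : Set (S → unitInterval)) : Set (S → unitInterval) := {b ∈ A | ∀ a ∈ X, a ≤ b}

/-- Lower bounds of `X` within `A` (pointwise order). -/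
def lb (A X : Set (S → unitInterval)) : Set (S → unitInterval) := {b ∈ A | ∀ a ∈ X, b ≤ a}

/-- `X` is a cut of `A` iff `X = l(uX)`. -/
def IsCutOf (A X : Set (S → unitInterval)) : Prop := X = lb A (ub A X)

/-- The limit condition: the pointwise infimum, over `a ∈ X` and `b ∈ uX`, of the truncated
difference `b ⊖ a` is the zero function. -/
def LimitCond (A X : Set (S → unitInterval)) : Prop :=
  pInf {γ | ∃ a ∈ X, ∃ b ∈ ub A X, γ = fun s => ominus (b s) (a s)} =
    fun _ => (0 : unitInterval)

/-- A limit cut is a cut satisfying the limit condition. -/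
def IsLimitCutOf (A X : Set (S → unitInterval)) : Prop := IsCutOf A X ∧ LimitCond A X

/-- `A` is limit cut complete: the pointwise supremum of every limit cut of `A` belongs
to `A`. -/
def IsLcc (A : Set (S → unitInterval)) : Prop :=
  ∀ X : Set (S → unitInterval), IsLimitCutOf A X → pSup X ∈ A

theorem pInf_apply_le {Γ : Set (S → unitInterval)} {γ : S → unitInterval} (hγ : γ ∈ Γ) (s : S) :
    pInf Γ s ≤ γ s :=
  iInf₂_le (f := fun (α : S → unitInterval) (_ : α ∈ Γ) => α s) γ hγ

theorem le_pSup_apply {Γ : Set (S → unitInterval)} {γ : S → unitInterval} (hγ : γ ∈ Γ) (s : S) :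
    γ s ≤ pSup Γ s :=
  le_iSup₂ (f := fun (α : S → unitInterval) (_ : α ∈ Γ) => α s) γ hγ

theorem exists_lt_of_pInf_lt {Γ : Set (S → unitInterval)} (hΓ : Γ.Nonempty) {s : S} {c : ℝ}
    (h : (pInf Γ s : ℝ) < c) : ∃ γ ∈ Γ, (γ s : ℝ) < c := by
  by_contra! hc
  obtain ⟨γ, hγ⟩ := hΓ
  have hle : (⟨c, (pInf Γ s).2.1.trans h.le, (hc γ hγ).trans (γ s).2.2⟩ : unitInterval) ≤
      pInf Γ s :=
    le_iInf₂ fun α hα => hc α hα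
  exact absurd h (not_lt.2 hle)

theorem exists_lt_of_lt_pSup {Γ : Set (S → unitInterval)} (hΓ : Γ.Nonempty) {s : S} {c : ℝ}
    (h : c < (pSup Γ s : ℝ)) : ∃ γ ∈ Γ, c < (γ s : ℝ) := by
  by_contra! hc
  obtain ⟨γ, hγ⟩ := hΓ
  have hle : pSup Γ s ≤
      (⟨c, (γ s).2.1.trans (hc γ hγ), h.le.trans (pSup Γ s).2.2⟩ : unitInterval) :=
    iSup₂_le fun α hα => hc α hα
  exact absurd h (not_lt.2 hle)

theorem pSup_eq_pInf_iff {P Q : Set (S → unitInterval)} (hP : P.Nonempty) (hQ : Q.Nonempty) :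
    pSup P = pInf Q ↔ (∀ a ∈ P, ∀ b ∈ Q, a ≤ b) ∧
      ∀ s, ∀ ε > (0 : ℝ), ∃ a ∈ P, ∃ b ∈ Q, (b s : ℝ) < a s + ε := by
  constructor
  · intro h
    refine ⟨fun a ha b hb s =>
      (le_pSup_apply ha s).trans ((congrFun h s).le.trans (pInf_apply_le hb s)), ?_⟩
    intro s ε hε
    have hs : (pSup P s : ℝ) = pInf Q s := congrArg Subtype.val (congrFun h s)
    obtain ⟨a, ha, hac⟩ :=
      exists_lt_of_lt_pSup (s := s) (c := (pSup P s : ℝ) - ε / 2) hP (by linarith)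
    obtain ⟨b, hb, hbc⟩ :=
      exists_lt_of_pInf_lt (s := s) (c := (pInf Q s : ℝ) + ε / 2) hQ (by linarith)
    exact ⟨a, ha, b, hb, by linarith⟩
  · rintro ⟨hle, hε⟩
    funext s
    apply le_antisymm
    · exact iSup₂_le fun a ha => le_iInf₂ fun b hb => hle a ha b hb s
    · refine Subtype.coe_le_coe.1 (le_of_forall_pos_le_add fun ε hpos => ?_)
      obtain ⟨a, ha, b, hb, hab⟩ := hε s ε hpos
      have hb' : (pInf Q s : ℝ) ≤ b s := pInf_apply_le hb s
      have ha' : (a s : ℝ) ≤ pSup P s := le_pSup_apply ha s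
      linarith

theorem limitCond_iff {A X : Set (S → unitInterval)} (hX : X.Nonempty) (hu : (ub A X).Nonempty) :
    LimitCond A X ↔
      ∀ s, ∀ ε > (0 : ℝ), ∃ a ∈ X, ∃ b ∈ ub A X, (b s : ℝ) < a s + ε := by
  constructor
  · intro h s ε hε
    obtain ⟨a, ha⟩ := hX
    obtain ⟨b, hb⟩ := hu
    have h0 : (pInf {γ | ∃ a ∈ X, ∃ b ∈ ub A X, γ = fun s => ominus (b s) (a s)} s : ℝ) = 0 :=
      congrArg Subtype.val (congrFun h s)
    have hne : {γ | ∃ a ∈ X, ∃ b ∈ ub A X, γ = fun s => ominus (b s) (a s)}.Nonempty :=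
      ⟨_, a, ha, b, hb, rfl⟩
    obtain ⟨_, ⟨a, ha, b, hb, rfl⟩, hlt⟩ := exists_lt_of_pInf_lt hne (h0.trans_lt hε)
    have hmax : (b s : ℝ) - a s ≤ (ominus (b s) (a s) : ℝ) := le_max_left _ _
    exact ⟨a, ha, b, hb, by linarith⟩
  · intro h
    funext s
    refine le_antisymm (Subtype.coe_le_coe.1 (le_of_forall_pos_le_add fun ε hε => ?_)) (pInf _ s).2.1
    obtain ⟨a, ha, b, hb, hab⟩ := h s ε hε
    have hmem : (fun s => ominus (b s) (a s)) ∈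
        {γ | ∃ a ∈ X, ∃ b ∈ ub A X, γ = fun s => ominus (b s) (a s)} :=
      ⟨a, ha, b, hb, rfl⟩
    have hle := pInf_apply_le hmem s
    have hmax : (ominus (b s) (a s) : ℝ) ≤ ε := max_le (by linarith) hε.le
    simpa using (Subtype.coe_le_coe.2 hle).trans hmax

theorem pStar_pStar_s2 (a : S → unitInterval) : pStar (pStar a) = a :=
  funext fun _ => unitInterval.symm_symm _

theorem pStar_le_pStar {a b : S → unitInterval} (h : a ≤ b) : pStar b ≤ pStar a :=
  fun s => unitInterval.symm_le_symm.2 (h s)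

theorem pStar_image_image (Y : Set (S → unitInterval)) : pStar '' (pStar '' Y) = Y := by
  simp [Set.image_image, pStar_pStar_s2]

theorem IsCutOf.subset {A X : Set (S → unitInterval)} (hX : IsCutOf A X) : X ⊆ A :=
  fun _ ha => (Eq.subset hX ha).1

theorem IsCutOf.nonempty {A X : Set (S → unitInterval)} (hX : IsCutOf A X)
    (hA : IsMVSubalgebra A) : X.Nonempty :=
  ⟨_, Eq.superset hX ⟨hA.1, fun b _ s => (b s).2.1⟩⟩

theorem ub_nonempty {A : Set (S → unitInterval)} (hA : IsMVSubalgebra A)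
    (X : Set (S → unitInterval)) : (ub A X).Nonempty :=
  ⟨_, hA.2.2 _ hA.1, fun a _ s => by simpa [pStar] using unitInterval.le_one'⟩

theorem pStar_image_lb {A : Set (S → unitInterval)} (hA : IsMVSubalgebra A)
    (X : Set (S → unitInterval)) : pStar '' lb A X = ub A (pStar '' X) := by
  ext b
  constructor
  · rintro ⟨c, ⟨hcA, hc⟩, rfl⟩
    refine ⟨hA.2.2 c hcA, ?_⟩
    rintro _ ⟨a, ha, rfl⟩
    exact pStar_le_pStar (hc a ha)
  · rintro ⟨hbA, hb⟩
    refine ⟨pStar b, ⟨hA.2.2 b hbA, fun a ha => ?_⟩, pStar_pStar_s2 b⟩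
    simpa only [pStar_pStar_s2] using pStar_le_pStar (hb _ ⟨a, ha, rfl⟩)

theorem pStar_image_ub {A : Set (S → unitInterval)} (hA : IsMVSubalgebra A)
    (X : Set (S → unitInterval)) : pStar '' ub A X = lb A (pStar '' X) := by
  rw [← pStar_image_image (lb A (pStar '' X)), pStar_image_lb hA, pStar_image_image]

theorem IsCutOf.pStar_image_ub {A X : Set (S → unitInterval)} (hX : IsCutOf A X)
    (hA : IsMVSubalgebra A) : IsCutOf A (pStar '' ub A X) := by
  unfold IsCutOf
  rw [← pStar_image_lb hA, ← hX, MVStone.pStar_image_ub hA]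

/-- If `pSup X = pInf Y*` for nonempty `X`, `Y` contained in `A`, then `X` satisfies the limit
condition. -/
theorem limitCond_of_pSup_eq {A X Y : Set (S → unitInterval)} (hA : IsMVSubalgebra A)
    (hX : X.Nonempty) (hY : Y.Nonempty) (hYA : Y ⊆ A) (h : pSup X = pInf (pStar '' Y)) :
    LimitCond A X := by
  obtain ⟨hle, hε⟩ := (pSup_eq_pInf_iff hX (hY.image _)).1 h
  refine (limitCond_iff hX (ub_nonempty hA X)).2 fun s ε hpos => ?_
  obtain ⟨a, ha, b, hb, hab⟩ := hε s ε hpos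
  refine ⟨a, ha, b, ⟨?_, fun a ha => hle a ha b hb⟩, hab⟩
  obtain ⟨y, hy, rfl⟩ := hb
  exact hA.2.2 y (hYA hy)

theorem pSup_eq_pInf_pStar_image_comm {X Y : Set (S → unitInterval)} (hX : X.Nonempty)
    (hY : Y.Nonempty) (h : pSup X = pInf (pStar '' Y)) : pSup Y = pInf (pStar '' X) := by
  obtain ⟨hle, hε⟩ := (pSup_eq_pInf_iff hX (hY.image _)).1 h
  refine (pSup_eq_pInf_iff hY (hX.image _)).2 ⟨?_, fun s ε hpos => ?_⟩
  · rintro y hy _ ⟨a, ha, rfl⟩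
    simpa only [pStar_pStar_s2] using pStar_le_pStar (hle a ha _ ⟨y, hy, rfl⟩)
  · obtain ⟨a, ha, _, ⟨y, hy, rfl⟩, hab⟩ := hε s ε hpos
    refine ⟨y, hy, _, ⟨a, ha, rfl⟩, ?_⟩
    simp only [pStar, unitInterval.coe_symm_eq] at hab ⊢
    linarith

theorem stmt2 {S : Type*} (A X : Set (S → unitInterval)) (hA : IsMVSubalgebra A)
    (hX : IsCutOf A X) :
    (IsLimitCutOf A X ↔ ∃ Y, IsCutOf A Y ∧ pSup X = pInf (pStar '' Y)) ∧
    ∀ Y, IsCutOf A Y → pSup X = pInf (pStar '' Y) → IsLimitCutOf A Y := by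
  have hXne := hX.nonempty hA
  refine ⟨⟨fun h => ⟨pStar '' ub A X, hX.pStar_image_ub hA, ?_⟩, ?_⟩, fun Y hY h => ⟨hY, ?_⟩⟩
  · rw [pStar_image_image]
    exact (pSup_eq_pInf_iff hXne (ub_nonempty hA X)).2
      ⟨fun a ha b hb => hb.2 a ha, (limitCond_iff hXne (ub_nonempty hA X)).1 h.2⟩
  · rintro ⟨Y, hY, h⟩
    exact ⟨hX, limitCond_of_pSup_eq hA hXne (hY.nonempty hA) hY.subset h⟩
  · exact limitCond_of_pSup_eq hA (hY.nonempty hA) hXne hX.subset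
      (pSup_eq_pInf_pStar_image_comm hXne (hY.nonempty hA) h)

end MVStone
end
end

section
/- An MV-subalgebra A of [0,1]^S is limit cut complete if and only if for all subsets X, Y of A and every function α : S → [0,1], if α is simultaneously the pointwise supremum of X and the pointwise infimum of Y, then α ∈ A. -/
open Set unitInterval

noncomputable section

namespace MVStone

variable {X : Type*}

variable {S : Type*}

theorem le_pSup_s3 {Γ : Set (S → unitInterval)} {a : S → unitInterval} (ha : a ∈ Γ) : a ≤ pSup Γ :=
  fun s => le_iSup₂ (f := fun (α : S → unitInterval) (_ : α ∈ Γ) => α s) a ha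

theorem pSup_le {Γ : Set (S → unitInterval)} {s : S} {t : unitInterval}
    (h : ∀ a ∈ Γ, a s ≤ t) : pSup Γ s ≤ t :=
  iSup₂_le h

theorem pInf_le {Γ : Set (S → unitInterval)} {a : S → unitInterval} (ha : a ∈ Γ) : pInf Γ ≤ a :=
  fun s => iInf₂_le (f := fun (α : S → unitInterval) (_ : α ∈ Γ) => α s) a ha

theorem le_pInf {Γ : Set (S → unitInterval)} {s : S} {t : unitInterval}
    (h : ∀ a ∈ Γ, t ≤ a s) : t ≤ pInf Γ s :=
  le_iInf₂ h

theorem pInf_le_pSup_of_limitCond {A X : Set (S → unitInterval)} (h : LimitCond A X) :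
    pInf (ub A X) ≤ pSup X := by
  intro s
  have hs : ominus (pInf (ub A X) s) (pSup X s) ≤ 0 := by
    rw [← congrFun h s]
    refine le_pInf ?_
    rintro _ ⟨a, ha, b, hb, rfl⟩
    have h1 : (a s).1 ≤ (pSup X s).1 := le_pSup_s3 ha s
    have h2 : (pInf (ub A X) s).1 ≤ (b s).1 := pInf_le hb s
    have h3 : max ((pInf (ub A X) s).1 - (pSup X s).1) 0 ≤ max ((b s).1 - (a s).1) 0 :=
      max_le_max (by linarith) le_rfl
    exact h3
  have h1 : max ((pInf (ub A X) s).1 - (pSup X s).1) 0 ≤ 0 := hs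
  have h2 : (pInf (ub A X) s).1 ≤ (pSup X s).1 := by
    linarith [le_max_left ((pInf (ub A X) s).1 - (pSup X s).1) 0]
  exact h2

theorem limitCond_of_pInf_le_pSup {A X : Set (S → unitInterval)} (hX : X.Nonempty)
    (hU : (ub A X).Nonempty) (h : pInf (ub A X) ≤ pSup X) : LimitCond A X := by
  funext s
  by_contra hne
  set g := pInf {γ | ∃ a ∈ X, ∃ b ∈ ub A X, γ = fun s => ominus (b s) (a s)} s
  have hpos : 0 < g.1 := lt_of_le_of_ne g.2.1 fun h0 => hne (Subtype.ext h0.symm)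
  have hgap : ∀ a ∈ X, ∀ b ∈ ub A X, (a s).1 + g.1 ≤ (b s).1 := by
    intro a ha b hb
    have h1 : g.1 ≤ max ((b s).1 - (a s).1) 0 :=
      pInf_le (Γ := {γ | ∃ a ∈ X, ∃ b ∈ ub A X, γ = fun s => ominus (b s) (a s)})
        (a := fun s => ominus (b s) (a s)) ⟨a, ha, b, hb, rfl⟩ s
    rcases le_max_iff.1 h1 with h2 | h2 <;> linarith
  obtain ⟨a₀, ha₀⟩ := hX
  obtain ⟨b₀, hb₀⟩ := hU
  have hsup : ∀ b ∈ ub A X, (pSup X s).1 + g.1 ≤ (b s).1 := by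
    intro b hb
    have hb0 : 0 ≤ (b s).1 - g.1 := by linarith [hgap a₀ ha₀ b hb, (a₀ s).2.1]
    have h1 : pSup X s ≤ ⟨(b s).1 - g.1, hb0, by linarith [(b s).2.2]⟩ :=
      pSup_le fun a ha => Subtype.coe_le_coe.1 (by have := hgap a ha b hb; simp only; linarith)
    have h2 : (pSup X s).1 ≤ (b s).1 - g.1 := h1
    linarith
  have h1 : (⟨(pSup X s).1 + g.1, add_nonneg (pSup X s).2.1 g.2.1,
      (hsup b₀ hb₀).trans (b₀ s).2.2⟩ : unitInterval) ≤ pInf (ub A X) s :=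
    le_pInf fun b hb => hsup b hb
  have h2 : (pSup X s).1 + g.1 ≤ (pSup X s).1 := h1.trans (h s)
  linarith

theorem subset_lb_ub {A X : Set (S → unitInterval)} (hX : X ⊆ A) : X ⊆ lb A (ub A X) :=
  fun a ha => ⟨hX ha, fun _ hb => hb.2 a ha⟩

theorem ub_lb_ub {A X : Set (S → unitInterval)} (hX : X ⊆ A) :
    ub A (lb A (ub A X)) = ub A X :=
  Subset.antisymm (fun _ hb => ⟨hb.1, fun a ha => hb.2 a (subset_lb_ub hX ha)⟩)
    fun b hb => ⟨hb.1, fun _ ha => ha.2 b hb⟩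

theorem IsMVSubalgebra.one_mem {A : Set (S → unitInterval)} (hA : IsMVSubalgebra A) :
    (fun _ => (1 : unitInterval)) ∈ A := by
  have h := hA.2.2 _ hA.1
  have h1 : pStar (fun _ : S => (0 : unitInterval)) = fun _ => 1 := by
    funext s
    simp [pStar]
  rwa [h1] at h

theorem stmt3 {S : Type*} (A : Set (S → unitInterval)) (hA : IsMVSubalgebra A) :
    IsLcc A ↔ ∀ X ⊆ A, ∀ Y ⊆ A, ∀ α : S → unitInterval,
      α = pSup X → α = pInf Y → α ∈ A := by
  constructor
  · intro hlcc X hX Y hY α hαX hαY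
    have hYU : Y ⊆ ub A X := fun b hb => ⟨hY hb, fun a ha =>
      (le_pSup_s3 ha).trans (hαX ▸ hαY ▸ pInf_le hb)⟩
    have hU := ub_lb_ub hX
    have hsup : pSup (lb A (ub A X)) = α := by
      refine le_antisymm (fun s => pSup_le fun a ha => ?_) (fun s => ?_)
      · rw [hαY]
        exact le_pInf fun b hb => ha.2 b (hYU hb) s
      · rw [hαX]
        exact pSup_le fun a ha => le_pSup_s3 (subset_lb_ub hX ha) s
    rw [← hsup]
    refine hlcc _ ⟨by rw [IsCutOf, hU], limitCond_of_pInf_le_pSup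
      ⟨_, hA.1, fun b _ s => (b s).2.1⟩ ?_ ?_⟩
    · rw [hU]
      exact ⟨_, hA.one_mem, fun a _ s => (a s).2.2⟩
    · rw [hU, hsup, hαY]
      exact fun s => le_pInf fun b hb => pInf_le (hYU hb) s
  · rintro h X ⟨hcut, hlim⟩
    refine h X (fun a ha => ?_) (ub A X) (fun b hb => hb.1) _ rfl
      (le_antisymm (fun s => pSup_le fun a ha => le_pInf fun b hb => hb.2 a ha s)
        (pInf_le_pSup_of_limitCond hlim))
    rw [hcut] at ha
    exact ha.1

end MVStone
end
end

section
/- Let X be a strongly compact Stone MV-space and let α be a clopen fuzzy subset of X. Then there exists a natural number n such that the n-fold sum nα = α ⊕ α ⊕ ⋯ ⊕ α equals the characteristic function of the support of α (the function taking value 1 at every x with α(x) > 0 and value 0 elsewhere); in particular nα is a {0,1}-valued (Boolean) clopen. -/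
open Set unitInterval

noncomputable section

namespace MVStone

variable {X : Type*}

/-- `n`-fold truncated sum `nα = α ⊕ ⋯ ⊕ α`. -/
def nOplus {X : Type*} : ℕ → (X → unitInterval) → X → unitInterval
  | 0, _ => fun _ => 0
  | n + 1, α => pOplus α (nOplus n α)

theorem coe_nOplus (n : ℕ) (α : X → unitInterval) (x : X) :
    (nOplus n α x : ℝ) = min (n * (α x : ℝ)) 1 := by
  have hα : (0 : ℝ) ≤ α x := (α x).2.1
  induction n with
  | zero => simp [nOplus]
  | succ n ih =>
    change min ((α x : ℝ) + (nOplus n α x : ℝ)) 1 = _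
    rw [ih, ← min_add_add_left, min_assoc, min_eq_right (by linarith : (1 : ℝ) ≤ α x + 1)]
    push_cast
    ring_nf

theorem IsMVTopology.nOplus_mem {Ω : Set (X → unitInterval)} (h : IsMVTopology Ω)
    {α : X → unitInterval} (hα : α ∈ Ω) (n : ℕ) : nOplus n α ∈ Ω := by
  induction n with
  | zero => exact h.zero_mem
  | succ n ih => exact h.oplus_mem _ hα _ ih

/-- A finite covering attains the value `1` at every point. -/
theorem IsCovering.exists_eq_one {F : Set (X → unitInterval)} (hF : F.Finite)
    (hc : IsCovering F) (x : X) : ∃ f ∈ F, f x = 1 := by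
  have hx : (⨆ f ∈ F, f x) = (1 : unitInterval) := congrFun hc x
  rcases F.eq_empty_or_nonempty with rfl | hne
  · have : (1 : unitInterval) ≤ 0 := hx ▸ iSup₂_le fun f hf => absurd hf (Set.notMem_empty f)
    exact absurd this (not_le_of_gt zero_lt_one)
  · obtain ⟨f, hf, hmax⟩ := Set.exists_max_image F (fun f => f x) hF hne
    exact ⟨f, hf, le_antisymm (f x).2.2 (hx ▸ iSup₂_le hmax)⟩

/-- The multiples of `α` together with its complement form a covering. -/
theorem isCovering_insert_pStar_range_nOplus (α : X → unitInterval) :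
    IsCovering (insert (pStar α) (Set.range fun n => nOplus n α)) := by
  funext x
  refine le_antisymm (pSup _ x).2.2 ?_
  rcases eq_or_lt_of_le (show (0 : unitInterval) ≤ α x from (α x).2.1) with h0 | hpos
  · refine le_trans ?_ (le_iSup₂_of_le (pStar α) (Set.mem_insert _ _) le_rfl)
    simp [pStar, ← h0]
  · have hpos' : (0 : ℝ) < α x := hpos
    obtain ⟨n, hn⟩ := Archimedean.arch (1 : ℝ) hpos'
    refine le_trans ?_
      (le_iSup₂_of_le (nOplus n α) (Set.mem_insert_of_mem _ (Set.mem_range_self n)) le_rfl)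
    change (1 : ℝ) ≤ nOplus n α x
    rw [coe_nOplus]
    exact le_min (by simpa using hn) le_rfl

theorem stmt5 {X : Type*} (Ω : Set (X → unitInterval))
    (h : IsStoneMVSpace Ω) (hsc : MVStronglyCompact Ω)
    (α : X → unitInterval) (hα : MVClopen Ω α) :
    ∃ n : ℕ, nOplus n α = fun x => if 0 < α x then (1 : unitInterval) else 0 := by
  obtain ⟨F, hFs, hFin, hcov⟩ := hsc _
    (Set.insert_subset hα.2 (Set.range_subset_iff.2 fun n => h.1.nOplus_mem hα.1 n))
    (isCovering_insert_pStar_range_nOplus α)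
  have hidx : ∀ f : X → unitInterval, ∃ n, f ∈ F → f = pStar α ∨ nOplus n α = f := fun f => by
    by_cases hf : f ∈ F
    · rcases hFs hf with hf' | ⟨n, hn⟩
      · exact ⟨0, fun _ => Or.inl hf'⟩
      · exact ⟨n, fun _ => Or.inr hn⟩
    · exact ⟨0, fun hf' => absurd hf' hf⟩
  choose g hg using hidx
  refine ⟨hFin.toFinset.sup g, ?_⟩
  funext x
  apply Subtype.ext
  rw [coe_nOplus]
  split_ifs with hpos
  · obtain ⟨f, hf, hfx⟩ := hcov.exists_eq_one hFin x
    have hpos' : (0 : ℝ) < α x := hpos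
    have hfx' : (f x : ℝ) = 1 := congrArg Subtype.val hfx
    rcases hg f hf with rfl | hn
    · have : 1 - (α x : ℝ) = 1 := hfx'
      linarith
    · have hle : g f ≤ hFin.toFinset.sup g := Finset.le_sup (hFin.mem_toFinset.2 hf)
      rw [← hn, coe_nOplus, min_eq_right_iff] at hfx'
      refine min_eq_right (hfx'.trans ?_)
      gcongr
  · have h0 : (α x : ℝ) = 0 := le_antisymm (not_lt.1 hpos) (α x).2.1
    simp [h0]

end MVStone
end
end

section
/- Let A be an MV-subalgebra of [0,1]^S and let B(A) = {a ∈ A : a ⊕ a = a} be its set of Boolean elements (equivalently, its {0,1}-valued members), which forms a Boolean algebra under pointwise ∨, ∧ and *. If M is a maximal ideal of A, then M ∩ B(A) is a maximal ideal of the Boolean algebra B(A). -/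
open Set unitInterval

noncomputable section

namespace MVStone

variable {X : Type*}

variable {S : Type*}

/-- Boolean elements of `A`: the idempotents for `⊕`. -/
def BooleanPart (A : Set (S → unitInterval)) : Set (S → unitInterval) :=
  {a ∈ A | pOplus a a = a}

/-- Ideal of the Boolean algebra `Bs` (a set of `{0,1}`-valued functions closed under the
pointwise Boolean operations): contains `0`, closed under pointwise `∨`, downward closed. -/
def IsBIdealOf (Bs J : Set (S → unitInterval)) : Prop :=
  J ⊆ Bs ∧ (fun _ => (0 : unitInterval)) ∈ J ∧ (∀ a ∈ J, ∀ b ∈ J, pMax a b ∈ J) ∧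
    ∀ a ∈ Bs, ∀ b ∈ J, a ≤ b → a ∈ J

def IsMaxBIdealOf (Bs J : Set (S → unitInterval)) : Prop :=
  IsBIdealOf Bs J ∧ J ≠ Bs ∧ ∀ N, IsBIdealOf Bs N → N ≠ Bs → J ⊆ N → J = N

lemma coe_oplus (a b : unitInterval) : (oplus a b : ℝ) = min (a.1 + b.1) 1 := rfl

lemma eq_zero_or_eq_one_of_oplus_self {a : unitInterval} (h : oplus a a = a) :
    a = 0 ∨ a = 1 := by
  have h' : min (a.1 + a.1) 1 = a.1 := congrArg Subtype.val h
  rcases min_choice (a.1 + a.1) 1 with h1 | h1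
  · left
    apply Subtype.ext
    change a.1 = 0
    linarith
  · right
    apply Subtype.ext
    change a.1 = 1
    linarith

lemma eq_zero_or_eq_one_of_mem_booleanPart {A : Set (S → unitInterval)}
    {a : S → unitInterval} (ha : a ∈ BooleanPart A) (s : S) : a s = 0 ∨ a s = 1 :=
  eq_zero_or_eq_one_of_oplus_self (congrFun ha.2 s)

lemma zero_oplus (a : unitInterval) : oplus 0 a = a := by
  apply Subtype.ext
  rw [coe_oplus]
  simpa using a.2.2

lemma one_oplus (a : unitInterval) : oplus 1 a = 1 := by
  apply Subtype.ext
  rw [coe_oplus]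
  simpa using a.2.1

lemma oplus_le_oplus {a b c d : unitInterval} (h₁ : a ≤ b) (h₂ : c ≤ d) :
    oplus a c ≤ oplus b d :=
  min_le_min_right _ (add_le_add (α := ℝ) h₁ h₂)

/-- On `{0,1}`-valued functions the truncated sum is the pointwise maximum. -/
lemma pMax_eq_pOplus {a b : S → unitInterval} (ha : ∀ s, a s = 0 ∨ a s = 1) :
    pMax a b = pOplus a b := by
  funext s
  change max (a s) (b s) = oplus (a s) (b s)
  rcases ha s with h | h <;> rw [h]
  · rw [zero_oplus]
    exact max_eq_right (b s).2.1
  · rw [one_oplus]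
    exact max_eq_left (b s).2.2

lemma mem_booleanPart_of_forall {A : Set (S → unitInterval)} {a : S → unitInterval}
    (ha : a ∈ A) (h : ∀ s, a s = 0 ∨ a s = 1) : a ∈ BooleanPart A := by
  refine ⟨ha, funext fun s => ?_⟩
  change oplus (a s) (a s) = a s
  rcases h s with h | h <;> rw [h]
  · rw [zero_oplus]
  · rw [one_oplus]

lemma one_mem_booleanPart {A : Set (S → unitInterval)} (hA : IsMVSubalgebra A) :
    (fun _ => (1 : unitInterval)) ∈ BooleanPart A := by
  refine mem_booleanPart_of_forall ?_ fun _ => Or.inr rfl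
  have h := hA.2.2 _ hA.1
  unfold pStar at h
  simpa only [symm_zero] using h

lemma pStar_mem_booleanPart {A : Set (S → unitInterval)} (hA : IsMVSubalgebra A)
    {a : S → unitInterval} (ha : a ∈ BooleanPart A) : pStar a ∈ BooleanPart A := by
  refine mem_booleanPart_of_forall (hA.2.2 _ ha.1) fun s => ?_
  rcases eq_zero_or_eq_one_of_mem_booleanPart ha s with h | h <;> simp [pStar, h]

lemma pMax_pStar_self {A : Set (S → unitInterval)} {a : S → unitInterval}
    (ha : a ∈ BooleanPart A) : pMax a (pStar a) = fun _ => 1 := by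
  rw [pMax_eq_pOplus (eq_zero_or_eq_one_of_mem_booleanPart ha)]
  funext s
  change oplus (a s) (σ (a s)) = 1
  rcases eq_zero_or_eq_one_of_mem_booleanPart ha s with h | h <;> rw [h]
  · rw [zero_oplus, symm_zero]
  · rw [one_oplus]

/-- The ideal generated by an ideal together with a Boolean element. -/
lemma isIdealOf_adjoin {A M : Set (S → unitInterval)} (hA : IsMVSubalgebra A)
    (hM : IsIdealOf A M) {a : S → unitInterval} (ha : a ∈ BooleanPart A) :
    IsIdealOf A {x ∈ A | ∃ m ∈ M, x ≤ pOplus a m} := by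
  refine ⟨fun x hx => hx.1, ⟨hA.1, _, hM.2.1, fun s => (pOplus a _ s).2.1⟩, ?_, ?_⟩
  · rintro x ⟨hx, m, hm, hxm⟩ y ⟨hy, n, hn, hyn⟩
    refine ⟨hA.2.1 x hx y hy, _, hM.2.2.1 m hm n hn, fun s => ?_⟩
    have h := oplus_le_oplus (hxm s) (hyn s)
    refine h.trans ?_
    change oplus (oplus (a s) (m s)) (oplus (a s) (n s)) ≤ oplus (a s) (oplus (m s) (n s))
    rcases eq_zero_or_eq_one_of_mem_booleanPart ha s with h | h <;> rw [h]
    · simp only [zero_oplus, le_refl]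
    · simp only [one_oplus, le_refl]
  · rintro x hx y ⟨-, m, hm, hym⟩ hxy
    exact ⟨hx, m, hm, hxy.trans hym⟩

/-- A maximal ideal contains each Boolean element or its complement. -/
lemma IsMaximalIdealOf.pStar_mem {A M : Set (S → unitInterval)} (hA : IsMVSubalgebra A)
    (hM : IsMaximalIdealOf A M) {a : S → unitInterval} (ha : a ∈ BooleanPart A)
    (haM : a ∉ M) : pStar a ∈ M := by
  obtain ⟨hI, -, hmax⟩ := hM
  have hle : M ⊆ {x ∈ A | ∃ m ∈ M, x ≤ pOplus a m} := fun x hx => by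
    refine ⟨hI.1 hx, x, hx, fun s => ?_⟩
    have h := oplus_le_oplus (show (0 : unitInterval) ≤ a s from (a s).2.1) (le_refl (x s))
    rwa [zero_oplus] at h
  have haN : a ∈ {x ∈ A | ∃ m ∈ M, x ≤ pOplus a m} := by
    refine ⟨ha.1, _, hI.2.1, fun s => ?_⟩
    change a s ≤ oplus (a s) 0
    rcases eq_zero_or_eq_one_of_mem_booleanPart ha s with h | h <;> rw [h]
    · rw [zero_oplus]
    · rw [one_oplus]
  have hN : {x ∈ A | ∃ m ∈ M, x ≤ pOplus a m} = A := by
    by_contra hne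
    exact haM (hmax _ (isIdealOf_adjoin hA hI ha) hne hle ▸ haN)
  obtain ⟨-, m, hm, h1⟩ := hN.symm ▸ (one_mem_booleanPart hA).1
  refine hI.2.2.2 _ (hA.2.2 _ ha.1) m hm fun s => ?_
  have h : (1 : ℝ) ≤ min ((a s).1 + (m s).1) 1 := h1 s
  change 1 - (a s).1 ≤ (m s).1
  linarith [h.trans (min_le_left _ _)]

theorem stmt7 {S : Type*} (A M : Set (S → unitInterval)) (hA : IsMVSubalgebra A)
    (hM : IsMaximalIdealOf A M) :
    IsMaxBIdealOf (BooleanPart A) (M ∩ BooleanPart A) := by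
  obtain ⟨hI, hne, -⟩ := id hM
  have h1 := one_mem_booleanPart hA
  refine ⟨⟨inter_subset_right, ⟨hI.2.1, ?_⟩, ?_, ?_⟩, ?_, ?_⟩
  · exact mem_booleanPart_of_forall hA.1 fun _ => Or.inl rfl
  · rintro a ⟨haM, ha⟩ b ⟨hbM, hb⟩
    have hab := pMax_eq_pOplus (b := b) (eq_zero_or_eq_one_of_mem_booleanPart ha)
    refine ⟨hab ▸ hI.2.2.1 a haM b hbM, mem_booleanPart_of_forall ?_ fun s => ?_⟩
    · exact hab ▸ hA.2.1 a ha.1 b hb.1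
    · rw [hab]
      change oplus (a s) (b s) = 0 ∨ oplus (a s) (b s) = 1
      rcases eq_zero_or_eq_one_of_mem_booleanPart ha s with h | h <;> rw [h]
      · rw [zero_oplus]
        exact eq_zero_or_eq_one_of_mem_booleanPart hb s
      · exact Or.inr (one_oplus _)
  · exact fun a ha b hb hab => ⟨hI.2.2.2 a ha.1 b hb.1 hab, ha⟩
  · intro h
    rw [← h] at h1
    exact hne (hI.1.antisymm fun a ha => hI.2.2.2 a ha _ h1.1 fun s => (a s).2.2)
  · refine fun N hN hNe hMN => hMN.antisymm fun a haN => ⟨?_, hN.1 haN⟩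
    by_contra haM
    have ha := hN.1 haN
    have hs := hMN ⟨hM.pStar_mem hA ha haM, pStar_mem_booleanPart hA ha⟩
    have h1N := hN.2.2.1 a haN _ hs
    rw [pMax_pStar_self ha] at h1N
    exact hNe (hN.1.antisymm fun b hb => hN.2.2.2 b hb _ h1N fun s => (b s).2.2)

end MVStone
end
end

section
/- Let B be a Boolean algebra, n ≥ 2, and let J_1, …, J_{n−1} be ideals of B satisfying J_i = J_{n−i} for all i = 1, …, n−1 and J_h ∩ J_{i−h} ⊆ J_i for all i = 2, …, n−1 and h = 1, …, i−1. Define R_J as the set of n-tuples (a_0, …, a_{n−1}) of elements of B such that a_{i−1} ≥ a_i and a_{i−1} ⊓ a_iᶜ ∈ J_i for all i = 1, …, n−1. Then for every i = 1, …, n−1, the set {a_{i−1} ⊓ a_iᶜ : (a_0, …, a_{n−1}) ∈ R_J} equals J_i. -/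
/-- Ideal of a Boolean algebra: contains `⊥`, closed under finite joins, downward closed. -/
def IsBoolIdeal {B : Type*} [BooleanAlgebra B] (J : Set B) : Prop :=
  ⊥ ∈ J ∧ (∀ a ∈ J, ∀ b ∈ J, a ⊔ b ∈ J) ∧ ∀ a b : B, b ∈ J → a ≤ b → a ∈ J

theorem stmt8 {B : Type*} [BooleanAlgebra B] (n : ℕ) (hn : 2 ≤ n) (J : ℕ → Set B)
    (hId : ∀ i, 1 ≤ i → i ≤ n - 1 → IsBoolIdeal (J i))
    (hsym : ∀ i, 1 ≤ i → i ≤ n - 1 → J i = J (n - i))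
    (hconv : ∀ i h, 2 ≤ i → i ≤ n - 1 → 1 ≤ h → h ≤ i - 1 → J h ∩ J (i - h) ⊆ J i) :
    ∀ i, 1 ≤ i → i ≤ n - 1 →
      {x : B | ∃ a : ℕ → B,
        (∀ j, 1 ≤ j → j ≤ n - 1 → a j ≤ a (j - 1) ∧ a (j - 1) ⊓ (a j)ᶜ ∈ J j) ∧
        x = a (i - 1) ⊓ (a i)ᶜ} = J i := by
  intro i hi hin
  ext x
  constructor
  · rintro ⟨a, ha, rfl⟩
    exact (ha i hi hin).2
  · intro hx
    refine ⟨fun j => if j < i then x else ⊥, fun j hj hjn => ?_, ?_⟩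
    · rcases lt_trichotomy j i with h | rfl | h
      · have h' : j - 1 < i := by omega
        simpa [h, h'] using (hId j hj hjn).1
      · have h' : j - 1 < j := by omega
        simpa [h'] using hx
      · have h' : ¬ j - 1 < i := by omega
        simpa [h.not_gt, h'] using (hId j hj hjn).1
    · have h' : i - 1 < i := by omega
      simp [h']
end

section
/- Let ⟨X, Ω⟩ be an MV-topological space. The following are equivalent: (i) for all x ≠ y in X there exist o_x, o_y ∈ Ω with o_x(x) = o_y(y) = 1 and o_x ∧ o_y = 0 (the Hausdorff property); (ii) for all x ≠ y in X there exist o'_x, o'_y ∈ Ω with o'_x(x) = o'_y(y) = 1 and o'_x ⊙ o'_y = 0. -/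
open Set unitInterval

noncomputable section

namespace MVStone

variable {X : Type*}

theorem min_eq_zero_iff_val (a b : unitInterval) : min a b = 0 ↔ a.1 = 0 ∨ b.1 = 0 := by
  have ha : (0 : unitInterval) ≤ a := a.2.1
  have hb : (0 : unitInterval) ≤ b := b.2.1
  constructor
  · intro h
    rcases le_total a b with hab | hab
    · left
      have : a ≤ min a b := le_inf le_rfl hab
      rw [h] at this
      exact congrArg Subtype.val (le_antisymm this ha)
    · right
      have : b ≤ min a b := le_inf hab le_rfl
      rw [h] at this
      exact congrArg Subtype.val (le_antisymm this hb)
  · rintro (h | h)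
    · obtain rfl : a = 0 := Subtype.ext h
      exact le_antisymm inf_le_left (le_inf le_rfl hb)
    · obtain rfl : b = 0 := Subtype.ext h
      exact le_antisymm inf_le_right (le_inf ha le_rfl)

theorem odot_eq_zero_iff (a b : unitInterval) : odot a b = 0 ↔ a.1 + b.1 ≤ 1 := by
  rw [Subtype.ext_iff]
  change max (a.1 + b.1 - 1) 0 = 0 ↔ _
  rw [max_eq_right_iff, sub_nonpos]

theorem odot_one_one : odot 1 1 = 1 := by
  apply Subtype.ext
  change max ((1 : ℝ) + 1 - 1) 0 = 1
  norm_num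

theorem odot_eq_zero_of_min_eq_zero {a b : unitInterval} (h : min a b = 0) : odot a b = 0 := by
  rw [odot_eq_zero_iff]
  have ha := a.2.2
  have hb := b.2.2
  rcases (min_eq_zero_iff_val a b).1 h with h | h <;> linarith

theorem min_odot_self_eq_zero {a b : unitInterval} (h : odot a b = 0) :
    min (odot a a) (odot b b) = 0 := by
  rw [odot_eq_zero_iff] at h
  rw [min_eq_zero_iff_val]
  rcases le_total a.1 b.1 with hab | hab
  · exact .inl (congrArg Subtype.val ((odot_eq_zero_iff a a).2 (by linarith)))
  · exact .inr (congrArg Subtype.val ((odot_eq_zero_iff b b).2 (by linarith)))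

theorem stmt13 {X : Type*} (Ω : Set (X → unitInterval)) (hΩ : IsMVTopology Ω) :
    MVHausdorff Ω ↔ ∀ x y : X, x ≠ y → ∃ ox ∈ Ω, ∃ oy ∈ Ω,
      ox x = 1 ∧ oy y = 1 ∧ pOdot ox oy = fun _ => 0 := by
  constructor
  · intro h x y hxy
    obtain ⟨ox, hox, oy, hoy, hx, hy, hmin⟩ := h x y hxy
    exact ⟨ox, hox, oy, hoy, hx, hy,
      funext fun z => odot_eq_zero_of_min_eq_zero (congrFun hmin z)⟩
  · intro h x y hxy
    obtain ⟨ox, hox, oy, hoy, hx, hy, hodot⟩ := h x y hxy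
    refine ⟨pOdot ox ox, hΩ.odot_mem _ hox _ hox, pOdot oy oy, hΩ.odot_mem _ hoy _ hoy, ?_, ?_,
      funext fun z => min_odot_self_eq_zero (congrFun hodot z)⟩
    · change odot (ox x) (ox x) = 1
      rw [hx, odot_one_one]
    · change odot (oy y) (oy y) = 1
      rw [hy, odot_one_one]

end MVStone
end
end

section
/- Let ⟨X, Ω⟩ be a Hausdorff MV-topological space. Then every crisp singleton is closed: for each x ∈ X, the function equal to 0 at x and to 1 at every other point belongs to Ω (i.e. the characteristic function of {x} is a closed fuzzy subset). -/
open Set unitInterval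

noncomputable section

namespace MVStone

variable {X : Type*}

theorem stmt14 {X : Type*} (Ω : Set (X → unitInterval)) (hΩ : IsMVTopology Ω)
    (hH : MVHausdorff Ω) (x : X) :
    (({x}ᶜ : Set X).indicator fun _ => (1 : unitInterval)) ∈ Ω := by
  have h : (({x}ᶜ : Set X).indicator fun _ => (1 : unitInterval)) = pSup {o ∈ Ω | o x = 0} := by
    funext y
    by_cases hyx : y = x
    · subst hyx
      rw [Set.indicator_of_notMem (by simp)]
      exact le_antisymm unitInterval.nonneg' (iSup₂_le fun o ho => ho.2.le)
    · rw [Set.indicator_of_mem (by simpa using hyx)]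
      obtain ⟨ox, -, oy, hoy, hx, hy, hxy⟩ := hH x y (Ne.symm hyx)
      have hoyx : oy x = 0 := by
        have h0 : min (ox x) (oy x) = 0 := congrFun hxy x
        rwa [hx, min_eq_right unitInterval.le_one'] at h0
      refine le_antisymm ?_ unitInterval.le_one'
      rw [← hy]
      exact le_iSup₂ (f := fun (o : X → unitInterval) (_ : o ∈ {o ∈ Ω | o x = 0}) => o y)
        oy ⟨hoy, hoyx⟩
  rw [h]
  exact hΩ.sSup_mem _ fun _ ho => ho.1

end MVStone
end
end

section
/- Let (X, d) be a metric space. For x ∈ X, v ∈ [0,1] and r > 0, define the open ball fuzzy subset β given by β(y) = v if d(x,y) < r and β(y) = 0 if d(x,y) ≥ r. Then the set of all fuzzy subsets of X that are pointwise suprema of families of such open balls is an MV-topology on X. -/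
open Set unitInterval

noncomputable section

namespace MVStone

variable {X : Type*}

/-- A fuzzy subset of a metric space is a supremum of open balls iff it is lower semicontinuous. -/
theorem exists_eq_pSup_balls_iff {X : Type*} [MetricSpace X] {α : X → unitInterval} :
    (∃ G ⊆ {β : X → unitInterval | ∃ (x : X) (v : unitInterval) (r : ℝ), 0 < r ∧
        β = fun y => if dist x y < r then v else 0}, α = pSup G) ↔ LowerSemicontinuous α := by
  constructor
  · rintro ⟨G, hG, rfl⟩ y c hc
    have h : ∃ β ∈ G, c < β y := by
      by_contra! h
      exact absurd hc (not_lt_of_ge (iSup₂_le h))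
    obtain ⟨β, hβ, hcβ⟩ := h
    obtain ⟨x, v, r, -, rfl⟩ := hG hβ
    have hy : dist x y < r := by
      by_contra hn
      simp only [hn, if_false] at hcβ
      exact absurd hcβ (not_lt_of_ge c.2.1)
    have hopen : IsOpen {z : X | dist x z < r} :=
      isOpen_lt (continuous_const.dist continuous_id) continuous_const
    filter_upwards [hopen.mem_nhds hy] with z hz
    have hz' : dist x z < r := hz
    simp only [hy, if_true] at hcβ
    refine lt_of_lt_of_le hcβ (le_trans (ge_of_eq ?_)
      (le_iSup₂ (f := fun (γ : X → unitInterval) (_ : γ ∈ G) => γ z) _ hβ))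
    simp only [hz', if_true]
  · intro hα
    refine ⟨{β | (∃ (x : X) (v : unitInterval) (r : ℝ), 0 < r ∧
        β = fun y => if dist x y < r then v else 0) ∧ ∀ z, β z ≤ α z}, fun β h => h.1, ?_⟩
    funext y
    refine le_antisymm (le_of_forall_lt fun c hc => ?_) (iSup₂_le fun β hβ => hβ.2 y)
    obtain ⟨c', hcc', hc'⟩ := exists_between hc
    obtain ⟨r, hr, hball⟩ := Metric.eventually_nhds_iff.1 (hα y c' hc')
    refine lt_of_lt_of_le hcc' (le_trans (ge_of_eq ?_)
      (le_iSup₂ (f := fun (γ : X → unitInterval) (_ : γ ∈ _) => γ y)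
        (fun z => if dist y z < r then c' else 0) ⟨⟨y, c', r, hr, rfl⟩, fun z => ?_⟩))
    · simp only [dist_self, hr, if_true]
    · dsimp only
      split_ifs with hz
      · exact (hball (by rwa [dist_comm])).le
      · exact (α z).2.1

theorem lowerSemicontinuous_pSup {X : Type*} [TopologicalSpace X] {Γ : Set (X → unitInterval)}
    (hΓ : ∀ α ∈ Γ, LowerSemicontinuous α) : LowerSemicontinuous (pSup Γ) := by
  intro y c hc
  have h : ∃ β ∈ Γ, c < β y := by
    by_contra! h
    exact absurd hc (not_lt_of_ge (iSup₂_le h))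
  obtain ⟨β, hβ, hcβ⟩ := h
  filter_upwards [hΓ β hβ y c hcβ] with z hz
  exact lt_of_lt_of_le hz (le_iSup₂ (f := fun (γ : X → unitInterval) (_ : γ ∈ Γ) => γ z) β hβ)

theorem lowerSemicontinuous_coe_add {X : Type*} [TopologicalSpace X] {α β : X → unitInterval}
    (hα : LowerSemicontinuous α) (hβ : LowerSemicontinuous β) :
    LowerSemicontinuous fun x => (α x : ℝ) + (β x : ℝ) :=
  (continuous_subtype_val.comp_lowerSemicontinuous hα (Subtype.mono_coe _)).add
    (continuous_subtype_val.comp_lowerSemicontinuous hβ (Subtype.mono_coe _))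

theorem lowerSemicontinuous_pOplus {X : Type*} [TopologicalSpace X] {α β : X → unitInterval}
    (hα : LowerSemicontinuous α) (hβ : LowerSemicontinuous β) :
    LowerSemicontinuous (pOplus α β) := by
  have h : LowerSemicontinuous
      (projIcc (0 : ℝ) 1 zero_le_one ∘ fun x => (α x : ℝ) + (β x : ℝ)) :=
    continuous_projIcc.comp_lowerSemicontinuous (lowerSemicontinuous_coe_add hα hβ)
      (monotone_projIcc _)
  refine (funext fun x => ?_ : pOplus α β = _) ▸ h
  have h₁ := (α x).2.1
  have h₂ := (β x).2.1
  apply Subtype.ext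
  simp only [pOplus, oplus, Function.comp_apply, coe_projIcc]
  rw [max_eq_right (le_min zero_le_one (add_nonneg h₁ h₂)), min_comm]

theorem lowerSemicontinuous_pOdot {X : Type*} [TopologicalSpace X] {α β : X → unitInterval}
    (hα : LowerSemicontinuous α) (hβ : LowerSemicontinuous β) :
    LowerSemicontinuous (pOdot α β) := by
  have hmono : Monotone fun t : ℝ => projIcc (0 : ℝ) 1 zero_le_one (t - 1) :=
    fun s t hst => monotone_projIcc _ (sub_le_sub_right hst 1)
  have hcont : Continuous fun t : ℝ => projIcc (0 : ℝ) 1 zero_le_one (t - 1) :=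
    continuous_projIcc.comp (continuous_id.sub continuous_const)
  have h : LowerSemicontinuous ((fun t : ℝ => projIcc (0 : ℝ) 1 zero_le_one (t - 1)) ∘
      fun x => (α x : ℝ) + (β x : ℝ)) :=
    hcont.comp_lowerSemicontinuous (lowerSemicontinuous_coe_add hα hβ) hmono
  refine (funext fun x => ?_ : pOdot α β = _) ▸ h
  have h₁ := (α x).2.2
  have h₂ := (β x).2.2
  apply Subtype.ext
  simp only [pOdot, odot, Function.comp_apply, coe_projIcc]
  rw [min_eq_right (by linarith), max_comm]

theorem stmt17 {X : Type*} [MetricSpace X] :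
    IsMVTopology {α : X → unitInterval |
      ∃ G ⊆ {β : X → unitInterval | ∃ (x : X) (v : unitInterval) (r : ℝ), 0 < r ∧
        β = fun y => if dist x y < r then v else 0}, α = pSup G} := by
  simp only [exists_eq_pSup_balls_iff]
  exact
    { zero_mem := lowerSemicontinuous_const
      one_mem := lowerSemicontinuous_const
      sSup_mem := fun _ hΓ => lowerSemicontinuous_pSup hΓ
      oplus_mem := fun _ hα _ hβ => lowerSemicontinuous_pOplus hα hβ
      odot_mem := fun _ hα _ hβ => lowerSemicontinuous_pOdot hα hβ
      min_mem := fun _ hα _ hβ => LowerSemicontinuous.inf hα hβ }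

end MVStone
end
end
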